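/- arXiv:1305.1794 — 2 statements merged into one kernel-verified Lean document; each statement's English description precedes it below -/
import Mathlib

section
/- Suppose that Φ(μ, κ, λ) holds, that the topological space X is λ-compact and, in case λ is singular, suppose further that X is cf(λ)-compact. If Y ⊆ X, |Y| = κ, and every subset of Y of cardinality μ has a complete accumulation point, then Y has a complete accumulation point. -/
open Cardinal

universe u v w

/-- The Juhász–Szentmiklóssy principle `Φ(μ, κ, λ)`: there is a family
`{S ξ : ξ < λ}` of subsets of `κ`, each of cardinality `μ`, such that for every
`A ⊆ κ` with `|A| < κ`, the set `{ξ < λ : |A ∩ S ξ| = μ}` has cardinality `< λ`. -/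
def JSPhi (μ κ lam : Cardinal.{u}) : Prop :=
  ∃ S : lam.out → Set κ.out,
    (∀ ξ, #(S ξ) = μ) ∧
    ∀ A : Set κ.out, #A < κ →
      #{ξ : lam.out | #(↥(A ∩ S ξ)) = μ} < lam

/-- `x` is a complete accumulation point of a family `𝒴` of subsets of `X`:
`|{Y ∈ 𝒴 : Y ∩ U ≠ ∅}| = |𝒴|` for every neighborhood `U` of `x`. -/
def IsCapFamily {X : Type u} [TopologicalSpace X] (x : X) (𝒴 : Set (Set X)) : Prop :=
  ∀ U ∈ nhds x, #{Y : Set X | Y ∈ 𝒴 ∧ (Y ∩ U).Nonempty} = #𝒴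

/-- `x` is a complete accumulation point of a set `Y ⊆ X`:
`|Y ∩ U| = |Y|` for every neighborhood `U` of `x`. -/
def IsCapSet {X : Type u} [TopologicalSpace X] (x : X) (Y : Set X) : Prop :=
  ∀ U ∈ nhds x, #(↥(Y ∩ U)) = #Y

/-- `X` is `λ`-compact: every subset of `X` of cardinality `λ` has a complete
accumulation point. -/
def LamCompact (X : Type u) [TopologicalSpace X] (lam : Cardinal.{u}) : Prop :=
  ∀ Y : Set X, #Y = lam → ∃ x : X, IsCapSet x Y

/-- `X` is `𝒻`-`λ`-compact: every subfamily `𝒴 ⊆ 𝒻` of cardinality `λ` has a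
complete accumulation point. -/
def FamCompact {X : Type u} [TopologicalSpace X] (𝒻 : Set (Set X))
    (lam : Cardinal.{u}) : Prop :=
  ∀ 𝒴 ⊆ 𝒻, #𝒴 = lam → ∃ x : X, IsCapFamily x 𝒴

/-- There is a family of `c.ord.cof` many cardinals below `c`, each of whose subfamilies of full
size is cofinal below `c`. -/
theorem exists_cofinal_cardinals (c : Cardinal.{u}) :
    ∃ (ι : Type u) (d : ι → Cardinal.{u}), #ι = c.ord.cof ∧ (∀ i, d i < c) ∧
      ∀ A : Set ι, #A = c.ord.cof → ∀ ν < c, ∃ i ∈ A, ν ≤ d i := by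
  obtain ⟨s, hs, hs'⟩ := Ordinal.exists_ord_cof_eq c.ord.ToType
  rw [Ordinal.cof_toType] at hs'
  have hcard : #s = c.ord.cof := by
    have h := congrArg Ordinal.card hs'
    simpa using h
  refine ⟨s, fun a => #(Set.Iio (a : c.ord.ToType)), hcard, fun a => ?_, fun A hA ν hν => ?_⟩
  · simpa using mk_Iio_lt (a : c.ord.ToType) (by simp)
  · obtain ⟨w, hw⟩ : ∃ w : c.ord.ToType, #(Set.Iio w) = ν := by
      refine ⟨Ordinal.ToType.mk ⟨ν.ord, ord_lt_ord.2 hν⟩, ?_⟩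
      have h := Ordinal.typein_enum (α := c.ord.ToType) (· < ·) (o := ν.ord)
        (by simpa using ord_lt_ord.2 hν)
      have h' := congrArg Ordinal.card h
      rw [Ordinal.card_typein, card_ord] at h'
      exact h'
    obtain ⟨b, hb, hwb⟩ := hs w
    have hlt : #(Set.Iio (⟨b, hb⟩ : s)) < #A := by
      rw [hA, ← hcard]
      exact mk_Iio_lt _ (by rw [hs', hcard])
    obtain ⟨a, haA, hba⟩ : ∃ a ∈ A, (⟨b, hb⟩ : s) ≤ a := by
      by_contra! h
      exact hlt.not_ge (mk_le_mk_of_subset h)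
    refine ⟨a, haA, hw.ge.trans (mk_le_mk_of_subset ?_)⟩
    exact Set.Iio_subset_Iio (hwb.trans hba)

/-- A map into a set of size less than that of its infinite domain has fibers of arbitrarily large
size below the size of the domain. -/
theorem exists_lt_mk_fiber {J X : Type u} (f : J → X) (hJ : ℵ₀ ≤ #J) (hf : #(Set.range f) < #J)
    {c : Cardinal.{u}} (hc : c < #J) : ∃ y, c < #(f ⁻¹' {y}) := by
  by_contra! h
  refine (mul_lt_of_lt hJ hf hc).not_ge ?_
  calc #J = #(⋃ y : Set.range f, f ⁻¹' {(y : X)}) := by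
        rw [← mk_univ]
        congr 2
        ext j
        simp
    _ ≤ Cardinal.sum fun y : Set.range f => #(f ⁻¹' {(y : X)}) := mk_iUnion_le_sum_mk
    _ ≤ Cardinal.sum fun _ : Set.range f => c := sum_le_sum _ _ fun y => h y
    _ = #(Set.range f) * c := sum_const' _ _

/-- In a space that is both `#J`-compact and `cf #J`-compact, every `J`-indexed family of points has
a complete accumulation point, counted with multiplicity. -/
theorem LamCompact.exists_mk_preimage_eq {J X : Type u} [TopologicalSpace X] (hJ : ℵ₀ ≤ #J)
    (h₁ : LamCompact X #J) (h₂ : LamCompact X (#J).ord.cof) (f : J → X) :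
    ∃ x, ∀ U ∈ nhds x, #(f ⁻¹' U) = #J := by
  by_contra! h
  replace h : ∀ x, ∃ U ∈ nhds x, #(f ⁻¹' U) < #J := fun x =>
    (h x).imp fun U hU => ⟨hU.1, (mk_set_le _).lt_of_ne hU.2⟩
  have hrange : #(Set.range f) < #J := by
    refine mk_range_le.lt_of_ne fun heq => ?_
    obtain ⟨x, hx⟩ := h₁ _ heq
    obtain ⟨U, hU, hlt⟩ := h x
    refine hlt.not_ge ?_
    rw [← heq, ← hx U hU, ← Set.image_preimage_eq_range_inter]
    exact mk_image_le
  obtain ⟨ι, d, hι, hd, hcof⟩ := exists_cofinal_cardinals #J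
  choose g hg using fun i => exists_lt_mk_fiber f hJ hrange (hd i)
  have key : ∀ U : Set X, #(f ⁻¹' U) < #J → #(g ⁻¹' U) ≠ (#J).ord.cof := fun U hU hcard => by
    obtain ⟨i, hi, hle⟩ := hcof _ hcard _ hU
    refine (hle.trans_lt (hg i)).not_ge (mk_le_mk_of_subset (Set.preimage_mono ?_))
    exact Set.singleton_subset_iff.2 hi
  have hgrange : #(Set.range g) = (#J).ord.cof := by
    refine (mk_range_le.trans_eq hι).eq_of_not_lt fun hlt => ?_
    obtain ⟨y, hy⟩ := infinite_pigeonhole (Set.rangeFactorization g)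
      (hι ▸ (isRegular_cof (isSuccLimit_ord hJ)).aleph0_le) (by rwa [hι, Ordinal.cof_ord_cof])
    obtain ⟨U, hU, hlt⟩ := h y
    refine key U hlt (le_antisymm ((mk_set_le _).trans_eq hι) ?_)
    rw [← hι, ← hy]
    refine mk_le_mk_of_subset fun i hi => ?_
    have hgi : g i = y := congrArg Subtype.val hi
    exact Set.mem_preimage.2 (hgi ▸ mem_of_mem_nhds hU)
  obtain ⟨x, hx⟩ := h₂ _ hgrange
  obtain ⟨U, hU, hlt⟩ := h x
  refine key U hlt (le_antisymm ((mk_set_le _).trans_eq hι) ?_)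
  rw [← hgrange, ← hx U hU, ← Set.image_preimage_eq_range_inter]
  exact mk_image_le

/-- Corollary 2.2 (second part): if `Φ(μ, κ, λ)` holds, `X` is `λ`-compact (and
`cf λ`-compact in case `λ` is singular), `Y ⊆ X`, `|Y| = κ`, and every subset of
`Y` of cardinality `μ` has a complete accumulation point, then `Y` has a
complete accumulation point. -/
theorem local_set {X : Type u} [TopologicalSpace X]
    (μ κ lam : Cardinal.{u}) (hμ : ℵ₀ ≤ μ) (hκ : ℵ₀ ≤ κ) (hlam : ℵ₀ ≤ lam)
    (hPhi : JSPhi μ κ lam)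
    (hlamc : LamCompact X lam)
    (hcf : ¬ lam.IsRegular → LamCompact X lam.ord.cof)
    (Y : Set X) (hY : #Y = κ)
    (hsub : ∀ Z ⊆ Y, #Z = μ → ∃ x : X, IsCapSet x Z) :
    ∃ x : X, IsCapSet x Y := by
  by_contra! hno
  replace hno : ∀ x, ∃ U ∈ nhds x, #(↥(Y ∩ U)) < κ := fun x => by
    have hx := hno x
    simp only [IsCapSet, not_forall] at hx
    obtain ⟨U, hU, hne⟩ := hx
    exact ⟨U, hU, hY ▸ (mk_le_mk_of_subset Set.inter_subset_left).lt_of_ne hne⟩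
  obtain ⟨S, hS, hS'⟩ := hPhi
  obtain ⟨e⟩ : Nonempty (κ.out ≃ Y) := Cardinal.eq.1 (by rw [mk_out, hY])
  have he : Function.Injective fun a => (e a : X) := Subtype.val_injective.comp e.injective
  have hcap : ∀ ξ, ∃ x, IsCapSet x ((fun a => (e a : X)) '' S ξ) := fun ξ =>
    hsub _ (Set.image_subset_iff.2 fun a _ => (e a).2) (by rw [mk_image_eq he, hS])
  choose p hp using hcap
  have hcf' : LamCompact X lam.ord.cof := by
    by_cases hreg : lam.IsRegular
    · rwa [hreg.cof_ord]
    · exact hcf hreg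
  obtain ⟨x, hx⟩ := LamCompact.exists_mk_preimage_eq (J := lam.out) (by rwa [mk_out])
    (by rwa [mk_out]) (by rwa [mk_out]) p
  obtain ⟨U, hU, hlt⟩ := hno x
  obtain ⟨V, hVU, hVo, hxV⟩ := mem_nhds_iff.1 hU
  have hA : #((fun a => (e a : X)) ⁻¹' V) < κ := by
    rw [← mk_image_eq he]
    refine (mk_le_mk_of_subset ?_).trans_lt hlt
    rintro _ ⟨a, ha, rfl⟩
    exact ⟨(e a).2, hVU ha⟩
  refine (hS' _ hA).not_ge ?_
  refine ((mk_out lam).symm.trans (hx V (hVo.mem_nhds hxV)).symm).trans_le ?_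
  refine mk_le_mk_of_subset fun ξ hξ => ?_
  have hcard := hp ξ V (hVo.mem_nhds hξ)
  rw [← Set.image_inter_preimage, mk_image_eq he, mk_image_eq he, hS] at hcard
  rw [Set.mem_ofPred_eq, Set.inter_comm]
  exact hcard
end

section
/- If κ is a singular cardinal, D is a uniform ultrafilter over κ⁺, and D' is a uniform ultrafilter over cf(κ), then the product D × D' is κ-decomposable. -/
open Cardinal

universe u v w

/-- `D ⊆ P(I)` is `μ`-decomposable: there is `f : I → μ` with `f ⁻¹' Z ∉ D`
whenever `Z ⊆ μ` and `|Z| < μ`. -/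
def Decomposable {I : Type w} (D : Set (Set I)) (μ : Cardinal.{v}) : Prop :=
  ∃ f : I → μ.out, ∀ Z : Set μ.out, #Z < μ → f ⁻¹' Z ∉ D

/-- The product `D × D'` of two families of sets:
`X ∈ D × D'` iff `{i : {i' : (i, i') ∈ X} ∈ D'} ∈ D`. -/
def prodFam {I : Type w} {I' : Type v} (D : Set (Set I)) (D' : Set (Set I')) :
    Set (Set (I × I')) :=
  {X | {i : I | {i' : I' | (i, i') ∈ X} ∈ D'} ∈ D}

/-- Well-founded recursion for operators that only look at strictly smaller arguments. -/
theorem exists_eq_of_local {Y : Type u} {X : Type v} [LinearOrder Y] [WellFoundedLT Y] [Nonempty X]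
    (G : (Y → X) → Y → X) (hG : ∀ g g' b, (∀ k < b, g k = g' k) → G g b = G g' b) :
    ∃ g : Y → X, ∀ b, g b = G g b := by
  classical
  let F : ∀ b : Y, (∀ k, k < b → X) → X := fun b ih =>
    G (fun k => if h : k < b then ih k h else Classical.arbitrary X) b
  refine ⟨WellFoundedLT.fix F, fun b => ?_⟩
  rw [WellFoundedLT.fix_eq]
  exact hG _ _ _ fun k hk => by simp [hk]

/-- A normal function growing faster than a given operator on its restrictions. -/
theorem exists_isNormal_forall_le {X Y : Type u} [LinearOrder Y] [WellFoundedLT Y] [LinearOrder X]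
    [WellFoundedLT X] [Nonempty X] (hYX : #Y < Order.cof X) (Φ : (Y → X) → Y → X)
    (hΦ : ∀ g g' b, (∀ k ≤ b, g k = g' k) → Φ g b = Φ g' b) (hlt : ∀ g b, g b < Φ g b) :
    ∃ ξ : Y → X, Order.IsNormal ξ ∧ ∀ b c, b < c → Φ ξ b ≤ ξ c := by
  have hex : ∀ (g : Y → X) (b : Y), ∃ x, IsLUB (Φ g '' Set.Iio b) x := by
    intro g b
    have hne : (upperBounds (Φ g '' Set.Iio b)).Nonempty := by
      apply BddAbove.of_not_isCofinal
      intro hc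
      exact (Order.cof_le hc).not_gt ((mk_image_le.trans (mk_set_le _)).trans_lt hYX)
    exact ⟨_, (wellFounded_lt (α := X)).min_mem _ hne,
      fun y hy => not_lt.1 ((wellFounded_lt (α := X)).not_lt_min _ hy)⟩
  choose G hG using hex
  obtain ⟨ξ, hξ⟩ := exists_eq_of_local G (fun g g' b h => by
    have : Φ g '' Set.Iio b = Φ g' '' Set.Iio b :=
      Set.image_congr fun k hk => hΦ _ _ _ fun l hl => h l (hl.trans_lt hk)
    have h1 := hG g b
    rw [this] at h1
    exact h1.unique (hG g' b))
  have hle : ∀ b c, b < c → Φ ξ b ≤ ξ c := fun b c hbc => by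
    rw [hξ c]
    exact (hG ξ c).1 ⟨b, hbc, rfl⟩
  have hmono : StrictMono ξ := fun b c hbc => (hlt ξ b).trans_le (hle b c hbc)
  refine ⟨ξ, Order.isNormal_iff.2 ⟨hmono, fun o ho a ha => ?_⟩, hle⟩
  rw [hξ o]
  refine (hG ξ o).2 ?_
  rintro _ ⟨b, hb, rfl⟩
  obtain ⟨c, hbc, hco⟩ := ho.lt_iff_exists_lt.1 hb
  exact (hle b c hco).trans (ha c hbc)

/-- Every well-order has a club subset of size at most its cofinality. -/
theorem exists_isClub_mk_le_cof (α : Type u) [LinearOrder α] [WellFoundedLT α] :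
    ∃ s : Set α, IsClub s ∧ #s ≤ Order.cof α := by
  obtain hα | hα := topOrderOrNoTopOrder α
  · refine ⟨{⊤}, ⟨fun d hd hne _ a ha => ?_, IsCofinal.singleton_top⟩, by simp⟩
    rw [Set.Nonempty.subset_singleton_iff hne] at hd
    subst hd
    exact (isLUB_singleton.unique ha).symm
  · have : NoMaxOrder α := (noTopOrder_iff_noMaxOrder α).1 hα
    obtain ⟨R, hR, hRc⟩ := Order.exists_cof_eq α
    let E : Set α := {x | ∃ S ⊆ R, S.Nonempty ∧ IsLUB S x}
    have hRE : R ⊆ E := fun x hx => ⟨{x}, by simpa using hx, by simp, isLUB_singleton⟩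
    refine ⟨E, ⟨fun d hd hne _ x hx => ?_, hR.mono hRE⟩, ?_⟩
    · obtain ⟨y, hy⟩ := hne
      obtain ⟨S, hSR, ⟨s, hs⟩, hSy⟩ := hd hy
      refine ⟨R ∩ Set.Iic x, Set.inter_subset_left,
        ⟨s, hSR hs, (hSy.1 hs).trans (hx.1 hy)⟩, fun _ h => h.2, fun u hu => hx.2 fun z hz => ?_⟩
      obtain ⟨S', hSR', _, hSz⟩ := hd hz
      exact hSz.2 fun t ht => hu ⟨hSR' ht, (hSz.1 ht).trans (hx.1 hz)⟩
    · rw [← hRc]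
      have hne : ∀ x : α, (R ∩ Set.Ioi x).Nonempty := fun x => by
        obtain ⟨y, hy⟩ := exists_gt x
        obtain ⟨r, hr, hyr⟩ := hR y
        exact ⟨r, hr, hy.trans_le hyr⟩
      let m : α → α := fun x => (wellFounded_lt (α := α)).min _ (hne x)
      have hm : ∀ x, m x ∈ R ∩ Set.Ioi x := fun x => (wellFounded_lt (α := α)).min_mem _ (hne x)
      have hmin : ∀ x, ∀ r ∈ R, x < r → m x ≤ r := fun x r hr hxr =>
        not_lt.1 ((wellFounded_lt (α := α)).not_lt_min _ (⟨hr, hxr⟩ : r ∈ R ∩ Set.Ioi x))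
      have hlt : ∀ x, ∀ y ∈ E, x < y → m x < m y := by
        rintro x y ⟨S, hSR, -, hSy⟩ hxy
        obtain ⟨s, hs, hxs, hsy⟩ := hSy.exists_between hxy
        exact (hmin x s (hSR hs) hxs).trans_lt (hsy.trans_lt (hm y).2)
      refine mk_le_of_injective (f := fun x : E => (⟨m x, (hm x).1⟩ : R)) fun x y hxy => ?_
      have hxy' : m x = m y := congrArg Subtype.val hxy
      rcases lt_trichotomy x.1 y.1 with h | h | h
      · exact absurd hxy' (hlt _ _ y.2 h).ne
      · exact Subtype.ext h
      · exact absurd hxy' (hlt _ _ x.2 h).ne'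

theorem isClub_preimage_Iio {α : Type u} [LinearOrder α] {E : Set α} (hE : DirSupClosed E) {a : α}
    (ha : IsCofinal {x : Set.Iio a | (x : α) ∈ E}) : IsClub {x : Set.Iio a | (x : α) ∈ E} := by
  refine ⟨fun d hd hne _ x hx => ?_, ha⟩
  refine hE (d := Subtype.val '' d) ?_ (hne.image _) (.of_linearOrder _) (a := x) ⟨?_, ?_⟩
  · rintro _ ⟨y, hy, rfl⟩
    exact hd hy
  · rintro _ ⟨y, hy, rfl⟩
    exact hx.1 hy
  · intro u hu
    by_contra! hux
    exact hux.not_ge (hx.2 (show (⟨u, hux.trans x.2⟩ : Set.Iio a) ∈ upperBounds d from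
      fun y hy => hu ⟨y, hy, rfl⟩))

theorem exists_lt_of_cof_Iio {α : Type u} [LinearOrder α] {k : α}
    (hk : ℵ₀ ≤ Order.cof (Set.Iio k)) {x : α} (hx : x < k) : ∃ y < k, x < y := by
  by_contra! h
  have : Order.cof (Set.Iio k) = 1 := Order.cof_eq_one_iff.2 ⟨⟨x, hx⟩, fun y => h y.1 y.2⟩
  exact absurd (this ▸ hk) one_lt_aleph0.not_ge

theorem isSuccLimit_of_aleph0_le_cof_Iio {α : Type u} [LinearOrder α] {k : α}
    (hk : ℵ₀ ≤ Order.cof (Set.Iio k)) : Order.IsSuccLimit k := by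
  refine ⟨fun hmin => ?_, fun x hx => ?_⟩
  · have : IsEmpty (Set.Iio k) := ⟨fun x => hmin.not_lt x.2⟩
    rw [Order.cof_eq_zero] at hk
    exact absurd hk aleph0_pos.not_ge
  · obtain ⟨y, hyk, hxy⟩ := exists_lt_of_cof_Iio hk hx.lt
    exact hx.2 hxy hyk

/-- A club in a regular cardinal above `σ` has a limit point of cofinality `σ`. -/
theorem exists_cof_Iio_eq_and_isCofinal {σ : Cardinal.{u}} (hσ : σ.IsRegular) (Y : Type u)
    [LinearOrder Y] [WellFoundedLT Y] [IsRegularCardinalOrder Y] (hY : σ < #Y) {E : Set Y}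
    (hE : IsClub E) :
    ∃ a : Y, Order.cof (Set.Iio a) = σ ∧ IsCofinal {x : Set.Iio a | (x : Y) ∈ E} := by
  have hlt : σ.ord < Ordinal.type (α := Y) (· < ·) := by
    rw [← Cardinal.ord_cardinalMk]
    exact ord_lt_ord.2 hY
  obtain ⟨k, hk⟩ := Ordinal.typein_surj (α := Y) (· < ·) hlt
  have hcof : Order.cof (Set.Iio k) = σ := by rw [Order.cof_Iio, hk, hσ.cof_ord]
  have hlim := isSuccLimit_of_aleph0_le_cof_Iio (k := k) (hcof ▸ hσ.aleph0_le)
  have hN := hE.isNormal_enum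
  set f : Y → Y := Subtype.val ∘ Order.enum E hE.isCofinal with hf
  have hfE : ∀ x, f x ∈ E := fun x => (Order.enum E hE.isCofinal x).2
  let g : Set.Iio k → Set.Iio (f k) := fun x => ⟨f x, hN.strictMono x.2⟩
  have hg : StrictMono g := fun x y hxy => hN.strictMono hxy
  have hgc : IsCofinal (Set.range g) := fun y => by
    obtain ⟨x, hxk, hyx⟩ := (hN.lt_iff_exists_lt hlim).1 y.2
    exact ⟨_, ⟨⟨x, hxk⟩, rfl⟩, hyx.le⟩
  refine ⟨f k, (Order.cof_congr_of_strictMono hg hgc).symm.trans hcof, hgc.mono ?_⟩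
  rintro _ ⟨x, rfl⟩
  exact hfE x

/-- Club guessing on points of cofinality `σ` in a regular cardinal above `σ⁺`. -/
theorem exists_club_guessing {σ : Cardinal.{u}} (hσ : σ.IsRegular) (hσ' : ℵ₀ < σ) (Y : Type u)
    [LinearOrder Y] [WellFoundedLT Y] [IsRegularCardinalOrder Y] (hY : Order.succ σ < #Y) :
    ∃ C : ∀ a : Y, Set (Set.Iio a), ∀ E, IsClub E → ∃ a, IsCofinal (C a) ∧
      Order.cof (Set.Iio a) = σ ∧ ∀ x ∈ C a, (x : Y) ∈ E := by
  by_contra! hcon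
  have hσY : σ < #Y := (Order.lt_succ σ).trans hY
  have hcofY : Order.cof Y = #Y := Order.cof_eq_cardinalMk
  have hcofY' : Order.cof Y ≠ ℵ₀ := (hcofY ▸ hσ'.trans hσY).ne'
  choose C hC hCcard using fun a : Y => exists_isClub_mk_le_cof (Set.Iio a)
  choose W hW hWfail using fun E : Set Y => hcon fun a => C a ∩ {x | (x : Y) ∈ E}
  let Z := (Order.succ σ).ord.ToType
  have hZ : #Z = Order.succ σ := mk_ord_toType _
  obtain ⟨e, he⟩ := exists_eq_of_local (Y := Z) (X := Set Y)
    (fun g i => ⋂ i' ∈ Set.Iio i, W (g i')) (fun g g' b h =>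
      Set.iInter₂_congr fun i hi => by rw [h i hi])
  have hE : IsClub (⋂ i, W (e i)) := IsClub.iInter hcofY'
    (by rw [hcofY, Cardinal.lift_id, Cardinal.lift_id, hZ]; exact hY) fun i => hW _
  obtain ⟨a, ha, hEa⟩ := exists_cof_Iio_eq_and_isCofinal hσ Y hσY hE
  have hclub := (hC a).inter (ha ▸ hσ'.ne') (isClub_preimage_Iio hE.dirSupClosed hEa)
  have hsub : ∀ i, (⋂ i, W (e i)) ⊆ e i := fun i => by
    rw [he i]
    exact Set.subset_iInter₂ fun i' _ => Set.iInter_subset _ i'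
  have hx : ∀ i, ∃ x : Set.Iio a, x ∈ C a ∧ (x : Y) ∈ e i ∧ (x : Y) ∉ W (e i) := fun i => by
    obtain ⟨x, hx, hx'⟩ := hWfail (e i) a
      (hclub.isCofinal.mono fun x hx => ⟨hx.1, hsub i hx.2⟩) ha
    exact ⟨x, hx.1, hx.2, hx'⟩
  choose x hxC hxe hxW using hx
  have hlt : ∀ i i', i < i' → x i ≠ x i' := fun i i' hii h => by
    have h1 := hxe i'
    rw [he i', ← h] at h1
    exact hxW i (Set.mem_iInter₂.1 h1 i hii)
  have hinj : Function.Injective fun i => (⟨x i, hxC i⟩ : C a) := fun i i' h => by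
    have h' : x i = x i' := congrArg Subtype.val h
    rcases lt_trichotomy i i' with h1 | h1 | h1
    · exact absurd h' (hlt _ _ h1)
    · exact h1
    · exact absurd h'.symm (hlt _ _ h1)
  have := (mk_le_of_injective hinj).trans (hCcard a)
  rw [hZ, ha] at this
  exact (Order.lt_succ σ).not_ge this

theorem exists_mk_Iio_eq {κ μ : Cardinal.{u}} (h : μ < κ) :
    ∃ z : κ.ord.ToType, #(Set.Iio z) = μ := by
  have hlt : μ.ord < Ordinal.type (α := κ.ord.ToType) (· < ·) := by
    rw [Ordinal.type_toType]
    exact ord_lt_ord.2 h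
  obtain ⟨z, hz⟩ := Ordinal.typein_surj (α := κ.ord.ToType) (· < ·) hlt
  refine ⟨z, ?_⟩
  have := congrArg Ordinal.card hz
  rwa [Ordinal.card_typein, card_ord] at this

theorem mk_Iio_toType_lt {κ : Cardinal.{u}} (x : κ.ord.ToType) : #(Set.Iio x) < κ := by
  have := Cardinal.mk_Iio_lt x (by rw [mk_ord_toType, Ordinal.type_toType])
  rwa [mk_ord_toType] at this

theorem succ_lt_of_cof_ord_lt {κ : Cardinal.{u}} (hκ : ℵ₀ ≤ κ) (hsing : κ.ord.cof < κ)
    {μ : Cardinal.{u}} (hμ : μ < κ) : Order.succ μ < κ := by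
  refine (Order.succ_le_of_lt hμ).lt_of_ne fun h => ?_
  have hμ' : ℵ₀ ≤ μ := by
    by_contra! hlt
    exact (isSuccLimit_aleph0.succ_lt hlt).not_ge (h ▸ hκ)
  rw [← h, (isRegular_succ hμ').cof_ord] at hsing
  exact hsing.false

theorem aleph0_lt_of_cof_ord_lt {κ : Cardinal.{u}} (hκ : ℵ₀ ≤ κ) (hsing : κ.ord.cof < κ) :
    ℵ₀ < κ := by
  refine hκ.lt_of_ne fun h => ?_
  rw [← h, isRegular_aleph0.cof_ord] at hsing
  exact hsing.false

/-- A uniform ultrafilter on `cf κ` admits a function to infinite cardinals below `κ` that is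
eventually above each cardinal below `κ`. -/
theorem exists_cardinal_eventually_lt {κ : Cardinal.{u}} (hκ : ℵ₀ ≤ κ) (hsing : κ.ord.cof < κ)
    (D : Ultrafilter (κ.ord.cof).out) (hD : ∀ A ∈ D, #A = κ.ord.cof) :
    ∃ c : (κ.ord.cof).out → Cardinal.{u}, (∀ j, ℵ₀ ≤ c j) ∧ (∀ j, c j < κ) ∧
      ∀ μ < κ, ∀ᶠ j in (D : Filter _), μ < c j := by
  obtain ⟨S, hS, hSc⟩ := Order.exists_cof_eq κ.ord.ToType
  rw [Ordinal.cof_toType] at hSc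
  let L := (κ.ord.cof).ord.ToType
  have hL : #L = κ.ord.cof := mk_ord_toType _
  obtain ⟨e⟩ := Cardinal.eq.1 ((mk_out _).trans hL.symm)
  obtain ⟨g⟩ := Cardinal.eq.1 (hL.trans hSc.symm)
  have hinf : ℵ₀ ≤ κ.ord.cof :=
    Ordinal.aleph0_le_cof_iff.2 (Ordinal.one_lt_cof_iff.2 (isSuccLimit_ord hκ))
  have hbd : ∀ j, ∃ x, ∀ y ∈ (fun l => (g l : κ.ord.ToType)) '' Set.Iic (e j), y < x := fun j => by
    refine not_isCofinal_iff.1 fun hc => (Order.cof_le hc).not_gt ?_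
    rw [Ordinal.cof_toType]
    refine mk_image_le.trans_lt ?_
    have := Cardinal.mk_Iic_lt (e j) (by rw [hL, Ordinal.type_toType]) (by rwa [hL])
    rwa [hL] at this
  choose x hx using hbd
  refine ⟨fun j => max ℵ₀ #(Set.Iio (x j)), fun j => le_max_left _ _, fun j =>
    max_lt (aleph0_lt_of_cof_ord_lt hκ hsing) (mk_Iio_toType_lt _), fun μ hμ => ?_⟩
  obtain ⟨y, hy⟩ := exists_mk_Iio_eq (succ_lt_of_cof_ord_lt hκ hsing hμ)
  obtain ⟨s, hs, hys⟩ := hS y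
  by_contra hcon
  have hmem := Ultrafilter.compl_mem_iff_notMem.2 hcon
  have hsub : {j | μ < max ℵ₀ #(Set.Iio (x j))}ᶜ ⊆ e ⁻¹' Set.Iio (g.symm ⟨s, hs⟩) := by
    intro j hj
    by_contra hlt
    refine hj (show μ < max ℵ₀ #(Set.Iio (x j)) from lt_max_of_lt_right ?_)
    have hsx : s < x j := hx j s ⟨g.symm ⟨s, hs⟩, Set.mem_Iic.2 (not_lt.1 hlt), by simp⟩
    rw [← Order.succ_le_iff, ← hy]
    exact mk_le_mk_of_subset (Set.Iio_subset_Iio (hys.trans hsx.le))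
  have h1 := mk_le_mk_of_subset hsub
  rw [hD _ hmem] at h1
  refine h1.not_gt (lt_of_le_of_lt ?_ (mk_Iio_toType_lt (g.symm ⟨s, hs⟩)))
  exact mk_le_of_injective (f := fun j => (⟨e j.1, j.2⟩ : Set.Iio (g.symm ⟨s, hs⟩)))
    fun a b h => Subtype.ext (e.injective (congrArg Subtype.val h))

/-- A family of `κ⁺` functions into `κ` that is increasing modulo a filter, uniformly so along a
club of predecessors of each point of small cofinality. -/
theorem exists_eventually_increasing {κ : Cardinal.{u}} {J : Type u} (l : Filter J)
    (c : J → Cardinal.{u}) (hc : ∀ j, ℵ₀ ≤ c j) (hcκ : ∀ j, c j < κ)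
    (hcl : ∀ μ < κ, ∀ᶠ j in l, μ < c j) :
    ∃ (f : (Order.succ κ).ord.ToType → J → Ordinal.{u}) (E : ∀ a, Set (Set.Iio a)),
      (∀ a j, f a j < κ.ord) ∧ (∀ a, ∀ b < a, ∀ᶠ j in l, f b j < f a j) ∧
      (∀ a, IsClub (E a)) ∧
      ∀ a, Order.cof (Set.Iio a) < κ → ∀ᶠ j in l, ∀ b ∈ E a, f b j < f a j := by
  classical
  choose E hE hEcard using fun a : (Order.succ κ).ord.ToType =>
    exists_isClub_mk_le_cof (Set.Iio a)
  have he : ∀ a : (Order.succ κ).ord.ToType, Nonempty (Set.Iio a ↪ κ.ord.ToType) := fun a => by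
    have : #(Set.Iio a) ≤ #κ.ord.ToType := by
      rw [mk_ord_toType]
      exact Order.le_of_lt_succ (mk_Iio_toType_lt a)
    exact this
  let e := fun a => (he a).some
  choose z hz using fun j => exists_mk_Iio_eq (hcκ j)
  let A : ∀ a : (Order.succ κ).ord.ToType, J → Set (Set.Iio a) := fun a j =>
    {b | e a b < z j} ∪ {b | b ∈ E a ∧ #(E a) ≤ c j}
  have hA : ∀ a j, #(A a j) ≤ c j := fun a j => by
    refine (mk_union_le _ _).trans (add_le_of_le (hc j) ?_ ?_)
    · rw [← hz j]
      exact mk_le_of_injective (f := fun b : {b | e a b < z j} => (⟨e a b, b.2⟩ : Set.Iio (z j)))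
        fun b b' h => Subtype.ext ((e a).injective (congrArg Subtype.val h))
    · by_cases h : #(E a) ≤ c j
      · exact (mk_le_mk_of_subset fun b hb => hb.1).trans h
      · simp [h]
  obtain ⟨f, hf⟩ := exists_eq_of_local (Y := (Order.succ κ).ord.ToType) (X := J → Ordinal.{u})
    (fun g a j => ⨆ b : A a j, (g b.1.1 j + 1)) (fun g g' a h => by
      funext j
      exact iSup_congr fun b => by rw [h _ b.1.2])
  have hf' : ∀ a j, f a j = ⨆ b : A a j, (f b.1.1 j + 1) := fun a j => congrFun (hf a) j
  have hlt : ∀ a j, ∀ b ∈ A a j, f b j < f a j := fun a j b hb => by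
    rw [hf' a j]
    exact (Order.lt_add_one_iff.2 le_rfl).trans_le
      (Ordinal.le_iSup (fun b : A a j => f b.1.1 j + 1) ⟨b, hb⟩)
  refine ⟨f, E, fun a j => ?_, fun a b hb => ?_, hE, fun a ha => ?_⟩
  · refine lt_of_lt_of_le ?_ (ord_le_ord.2 (Order.succ_le_of_lt (hcκ j)))
    induction a using WellFoundedLT.induction with
    | ind a ih =>
      rw [hf' a j]
      refine Ordinal.iSup_add_one_lt_of_lt_cof ?_ fun b => ih _ b.1.2
      rw [(isRegular_succ (hc j)).cof_ord]
      exact Order.lt_succ_of_le (hA a j)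
  · filter_upwards [hcl _ (mk_Iio_toType_lt (e a ⟨b, hb⟩))] with j hj
    refine hlt a j ⟨b, hb⟩ (Or.inl (show e a ⟨b, hb⟩ < z j from ?_))
    by_contra hle
    have := mk_le_mk_of_subset (Set.Iio_subset_Iio (not_lt.1 hle))
    rw [hz j] at this
    exact hj.not_ge this
  · filter_upwards [hcl _ ((hEcard a).trans_lt ha)] with j hj b hb
    exact hlt a j b (Or.inr ⟨hb, hj.le⟩)

theorem isClub_preimage_of_isNormal {X Y : Type u} [LinearOrder Y] [WellFoundedLT Y]
    [LinearOrder X] [WellFoundedLT X] {g : Y → X} (hg : Order.IsNormal g)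
    (hgc : IsCofinal (Set.range g)) (hX : Order.cof X ≠ ℵ₀) {E : Set X} (hE : IsClub E) :
    IsClub (g ⁻¹' E) := by
  refine ⟨fun d hd hne _ i hi => ?_, fun b => ?_⟩
  · exact hE.isLUB_mem (Set.image_subset_iff.2 hd) (hne.image g) (hg.map_isLUB hi hne)
  · have hR : IsClub (Set.range g) := by
      refine ⟨fun d hd hne _ x hx => ?_, hgc⟩
      obtain ⟨_, ⟨b, rfl⟩, hb⟩ := hgc x
      have hbd : (upperBounds (g ⁻¹' d)).Nonempty :=
        ⟨b, fun i hi => hg.strictMono.le_iff_le.1 ((hx.1 hi).trans hb)⟩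
      have hlub : IsLUB (g ⁻¹' d) ((wellFounded_lt (α := Y)).min _ hbd) :=
        ⟨(wellFounded_lt (α := Y)).min_mem _ hbd,
          fun y hy => not_lt.1 ((wellFounded_lt (α := Y)).not_lt_min _ hy)⟩
      have hne' : (g ⁻¹' d).Nonempty := by
        obtain ⟨y, hy⟩ := hne
        obtain ⟨i, rfl⟩ := hd hy
        exact ⟨i, hy⟩
      have := hg.map_isLUB hlub hne'
      rw [Set.image_preimage_eq_of_subset hd] at this
      exact ⟨_, this.unique hx⟩
    obtain ⟨_, ⟨⟨i, rfl⟩, hi⟩, hbi⟩ := (hR.inter hX hE).isCofinal (g b)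
    exact ⟨i, hi, hg.strictMono.le_iff_le.1 hbi⟩

theorem isRegularCardinalOrder_toType {ρ : Cardinal.{u}} (hρ : ρ.IsRegular) :
    IsRegularCardinalOrder ρ.ord.ToType :=
  ⟨by rw [Ordinal.type_toType, Ordinal.cof_toType, hρ.cof_ord]⟩

/-- No cofinal set of members of an increasing family with values in `κ` can have almost all of its
values in a fixed set of size less than `κ`. -/
theorem not_forall_eventually_mem {κ : Cardinal.{u}} (hκ : ℵ₀ < κ)
    (hlim : ∀ μ < κ, Order.succ μ < κ) {J K : Type u} (l : Filter J) [l.NeBot] (hJ : #J < κ)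
    (f : (Order.succ κ).ord.ToType → J → Ordinal.{u}) (E : ∀ a, Set (Set.Iio a))
    (hf : ∀ a, ∀ b < a, ∀ᶠ j in l, f b j < f a j) (hE : ∀ a, IsClub (E a))
    (hfE : ∀ a, Order.cof (Set.Iio a) < κ → ∀ᶠ j in l, ∀ b ∈ E a, f b j < f a j)
    (v : (Order.succ κ).ord.ToType → J → K) (hv : ∀ a b j, v a j = v b j → f a j = f b j)
    (T : Set (Order.succ κ).ord.ToType) (hT : ∀ x, ∃ t ∈ T, x < t) (Z : Set K) (hZ : #Z < κ)
    (hTZ : ∀ t ∈ T, ∀ᶠ j in l, v t j ∈ Z) : False := by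
  classical
  let X := (Order.succ κ).ord.ToType
  have hX : Order.cof X = Order.succ κ := by
    rw [Ordinal.cof_toType, (isRegular_succ hκ.le).cof_ord]
  have : Nonempty X := by
    rw [← Order.cof_ne_zero_iff, hX]
    exact (Order.bot_lt_succ κ).ne'
  have hup : ∀ S : Set X, ∃ x, #S ≤ κ → ∀ y ∈ S, y < x := fun S => by
    by_cases hS : #S ≤ κ
    · obtain ⟨x, hx⟩ := not_isCofinal_iff.1 fun hc : IsCofinal S =>
        (Order.cof_le hc).not_gt (by
          rw [hX]
          exact Order.lt_succ_of_le hS)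
      exact ⟨x, fun _ => hx⟩
    · exact ⟨Classical.arbitrary X, fun h => absurd h hS⟩
  choose up hup using hup
  let τ := max ℵ₀ (max #J #Z)
  have hτ : τ < κ := max_lt hκ (max_lt hJ hZ)
  have hτ0 : ℵ₀ ≤ τ := le_max_left _ _
  have hσ := isRegular_succ hτ0
  have hσ0 : ℵ₀ < Order.succ τ := Order.lt_succ_of_le hτ0
  have hρ := isRegular_succ (hσ0.le.trans (Order.le_succ (Order.succ τ)))
  set ρ := Order.succ (Order.succ (Order.succ τ))
  have hρκ : ρ < κ := hlim _ (hlim _ (hlim _ hτ))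
  have hρ0 : ℵ₀ < ρ := hσ0.trans ((Order.lt_succ _).trans (Order.lt_succ _))
  let Y := ρ.ord.ToType
  have hYcard : #Y = ρ := mk_ord_toType _
  have : IsRegularCardinalOrder Y := isRegularCardinalOrder_toType hρ
  have hYcof : Order.cof Y = ρ := by rw [Order.cof_eq_cardinalMk, hYcard]
  have hYmax : ∀ b : Y, ∃ c, b < c := fun b => by
    obtain ⟨c, hc⟩ := not_isCofinal_iff.1 fun hc : IsCofinal ({b} : Set Y) =>
      (Order.cof_le hc).not_gt (by
        rw [hYcof, mk_singleton]
        exact one_lt_aleph0.trans hρ0)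
    exact ⟨c, hc b rfl⟩
  obtain ⟨C, hC⟩ := exists_club_guessing hσ hσ0 Y (hYcard ▸ Order.lt_succ _)
  let C' : Y → Set Y := fun a => Subtype.val '' C a
  let P : Set X → X → Prop := fun Q z =>
    z ∈ T ∧ ∀ᶠ j in l, ∀ q ∈ Q, f q j < f z j
  have hζ : ∀ Q, ∃ z, (∃ z', P Q z') → P Q z := fun Q => by
    by_cases h : ∃ z', P Q z'
    · obtain ⟨z', hz'⟩ := h
      exact ⟨z', fun _ => hz'⟩
    · exact ⟨Classical.arbitrary X, fun h' => absurd h' h⟩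
  choose ζ hζ using hζ
  let S : (Y → X) → Y → Set X := fun g b =>
    insert (g b) (Set.range fun a => ζ (g '' (C' a ∩ Set.Iic b)))
  have hS : ∀ g b, #(S g b) ≤ κ := fun g b => by
    refine mk_insert_le.trans (add_le_of_le hκ.le ?_ (one_lt_aleph0.trans hκ).le)
    exact mk_range_le.trans (hYcard.trans_le hρκ.le)
  obtain ⟨ξ, hξ, hξle⟩ := exists_isNormal_forall_le (X := X) (Y := Y)
    (by rw [hX, hYcard]; exact Order.lt_succ_of_le hρκ.le) (fun g b => up (S g b))
    (fun g g' b h => by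
      have h1 : ∀ a, g '' (C' a ∩ Set.Iic b) = g' '' (C' a ∩ Set.Iic b) := fun a =>
        Set.image_congr fun k hk => h k hk.2
      simp only [S, h1, h b le_rfl])
    (fun g b => hup _ (hS g b) _ (Set.mem_insert _ _))
  have hbd : (upperBounds (Set.range ξ)).Nonempty :=
    ⟨up (Set.range ξ), fun y hy =>
      (hup _ (mk_range_le.trans (hYcard.trans_le hρκ.le)) y hy).le⟩
  obtain ⟨δ, hδ⟩ : ∃ δ, IsLUB (Set.range ξ) δ :=
    ⟨_, (wellFounded_lt (α := X)).min_mem _ hbd,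
      fun y hy => not_lt.1 ((wellFounded_lt (α := X)).not_lt_min _ hy)⟩
  have hξδ : ∀ b, ξ b < δ := fun b => by
    obtain ⟨c, hc⟩ := hYmax b
    exact (hξ.strictMono hc).trans_le (hδ.1 ⟨c, rfl⟩)
  let g : Y → Set.Iio δ := fun b => ⟨ξ b, hξδ b⟩
  have hg : Order.IsNormal g := by
    refine Order.isNormal_iff.2 ⟨fun b c h => hξ.strictMono h, fun o ho x hx => ?_⟩
    exact (Order.isNormal_iff.1 hξ).2 o ho x hx
  have hgc : IsCofinal (Set.range g) := fun y => by
    obtain ⟨_, ⟨b, rfl⟩, hb⟩ := (lt_isLUB_iff hδ).1 y.2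
    exact ⟨_, ⟨b, rfl⟩, hb.le⟩
  have hδcof : Order.cof (Set.Iio δ) = ρ :=
    (Order.cof_congr_of_strictMono hg.strictMono hgc).symm.trans hYcof
  obtain ⟨a, hCa, hcofa, hCE⟩ := hC _
    (isClub_preimage_of_isNormal hg hgc (hδcof ▸ hρ0.ne') (hE δ))
  obtain ⟨t, htT, hδt⟩ := hT δ
  have hP : ∀ b, P (ξ '' (C' a ∩ Set.Iic b)) (ζ (ξ '' (C' a ∩ Set.Iic b))) := fun b => by
    refine hζ _ ⟨t, htT, ?_⟩
    filter_upwards [hfE δ (hδcof ▸ hρκ), hf t δ hδt] with j h1 h2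
    rintro _ ⟨_, ⟨⟨x, hx, rfl⟩, -⟩, rfl⟩
    exact (h1 _ (hCE x hx)).trans h2
  have hnext : ∀ x : C a, ∃ y : Y, y ∈ C' a ∧ x.1.1 < y ∧ ∀ z ∈ C' a, x.1.1 < z → y ≤ z :=
    fun x => by
    obtain ⟨y, hya, hxy⟩ := exists_lt_of_cof_Iio (k := a) (hcofa ▸ hσ0.le) x.1.2
    obtain ⟨w, hw, hyw⟩ := hCa ⟨y, hya⟩
    have hne : {z | z ∈ C' a ∧ x.1.1 < z}.Nonempty :=
      ⟨w, ⟨w, hw, rfl⟩, hxy.trans_le hyw⟩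
    have hmem := (wellFounded_lt (α := Y)).min_mem _ hne
    exact ⟨_, hmem.1, hmem.2, fun z hz hxz =>
      not_lt.1 ((wellFounded_lt (α := Y)).not_lt_min _ (show z ∈ {z | z ∈ C' a ∧ x.1.1 < z} from
        ⟨hz, hxz⟩))⟩
  choose nx hnxC hnx hnxle using hnext
  have hj : ∀ x : C a, ∃ j,
      (∀ q ∈ ξ '' (C' a ∩ Set.Iic x.1.1), f q j < f (ζ (ξ '' (C' a ∩ Set.Iic x.1.1))) j) ∧
      f (ζ (ξ '' (C' a ∩ Set.Iic x.1.1))) j < f (ξ (nx x)) j ∧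
      v (ζ (ξ '' (C' a ∩ Set.Iic x.1.1))) j ∈ Z := fun x => by
    have hlt : ζ (ξ '' (C' a ∩ Set.Iic x.1.1)) < ξ (nx x) :=
      (hup _ (hS ξ x.1.1) _ (Set.mem_insert_of_mem _ ⟨a, rfl⟩)).trans_le (hξle _ _ (hnx x))
    exact ((hP x.1.1).2.and ((hf _ _ hlt).and (hTZ _ (hP x.1.1).1))).exists
  choose jj hj1 hj2 hj3 using hj
  have hne : ∀ x y : C a, x.1.1 < y.1.1 → jj x = jj y →
      v (ζ (ξ '' (C' a ∩ Set.Iic x.1.1))) (jj x) ≠ v (ζ (ξ '' (C' a ∩ Set.Iic y.1.1))) (jj y) := by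
    intro x y hxy hjj h
    have h1 := hj2 x
    rw [hjj] at h h1
    refine (h1.trans (hj1 y _ ⟨nx x, ⟨hnxC x, ?_⟩, rfl⟩)).ne (hv _ _ _ h)
    exact hnxle x _ ⟨y.1, y.2, rfl⟩ hxy
  have hinj : Function.Injective fun x : C a => ((jj x, ⟨_, hj3 x⟩) : J × Z) := fun x y h => by
    have h1 : jj x = jj y := congrArg Prod.fst h
    have h2 := congrArg (fun p => p.2.1) h
    rcases lt_trichotomy x.1.1 y.1.1 with hxy | hxy | hxy
    · exact absurd h2 (hne x y hxy h1)
    · exact Subtype.ext (Subtype.ext hxy)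
    · exact absurd h2.symm (hne y x hxy h1.symm)
  have hle : Order.succ τ ≤ τ := by
    calc Order.succ τ = Order.cof (Set.Iio a) := hcofa.symm
      _ ≤ #(C a) := Order.cof_le hCa
      _ ≤ #(J × Z) := mk_le_of_injective hinj
      _ = #J * #Z := by simp
      _ ≤ τ * τ := mul_le_mul' ((le_max_left _ _).trans (le_max_right _ _))
          ((le_max_right _ _).trans (le_max_right _ _))
      _ = τ := mul_eq_self hτ0
  exact (Order.lt_succ τ).not_ge hle

/-- The application stated in the abstract: if `κ` is singular, `D` is a uniform
ultrafilter over `κ⁺` and `D'` is a uniform ultrafilter over `cf κ`, then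
`D' × D`... stated here for the product `D × D'`: it is `κ`-decomposable. -/
theorem prod_ultrafilter_decomposable
    (κ : Cardinal.{u}) (hκ : ℵ₀ ≤ κ) (hsing : κ.ord.cof < κ)
    (D : Ultrafilter (Order.succ κ).out)
    (D' : Ultrafilter (κ.ord.cof).out)
    (hD : ∀ A ∈ D, #A = Order.succ κ)
    (hD' : ∀ A ∈ D', #A = κ.ord.cof) :
    Decomposable (prodFam {A | A ∈ D} {A | A ∈ D'}) κ := by
  have hκ' := aleph0_lt_of_cof_ord_lt hκ hsing
  obtain ⟨c, hc, hcκ, hcl⟩ := exists_cardinal_eventually_lt hκ hsing D' hD'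
  obtain ⟨f, E, hfκ, hf, hE, hfE⟩ := exists_eventually_increasing
    (D' : Filter (κ.ord.cof).out) c hc hcκ hcl
  obtain ⟨e⟩ := Cardinal.eq.1 ((mk_out (Order.succ κ)).trans (mk_ord_toType _).symm)
  obtain ⟨e'⟩ := Cardinal.eq.1 ((mk_ord_toType κ).trans (mk_out κ).symm)
  refine ⟨fun p => e' (Ordinal.ToType.mk ⟨f (e p.1) p.2, hfκ _ _⟩), fun Z hZ hmem => ?_⟩
  refine not_forall_eventually_mem hκ' (fun _ => succ_lt_of_cof_ord_lt hκ hsing)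
    (D' : Filter (κ.ord.cof).out) (by rwa [mk_out]) f E hf hE hfE
    (fun a j => e' (Ordinal.ToType.mk ⟨f a j, hfκ _ _⟩)) (fun a b j h => ?_)
    {a | ∀ᶠ j in (D' : Filter (κ.ord.cof).out),
      e' (Ordinal.ToType.mk ⟨f a j, hfκ _ _⟩) ∈ Z}
    (fun x => ?_) Z hZ (fun t ht => ht)
  · exact congrArg Subtype.val (Ordinal.ToType.mk.injective (e'.injective h))
  · by_contra! hcon
    have hle : #{i | ∀ᶠ j in (D' : Filter (κ.ord.cof).out),
        e' (Ordinal.ToType.mk ⟨f (e i) j, hfκ _ _⟩) ∈ Z} ≤ #(Set.Iic x) :=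
      mk_le_of_injective (f := fun i => (⟨e i.1, hcon _ i.2⟩ : Set.Iic x))
        fun a b h => Subtype.ext (e.injective (congrArg Subtype.val h))
    have hlt := Cardinal.mk_Iic_lt x (by rw [mk_ord_toType, Ordinal.type_toType])
      (by rw [mk_ord_toType]; exact hκ.trans (Order.le_succ κ))
    rw [mk_ord_toType] at hlt
    exact (hle.trans_lt hlt).ne (hD _ hmem)
end
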